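/- arXiv:1408.5837 — 2 statements merged into one kernel-verified Lean document; each statement's English description precedes it below -/
import Mathlib

section
/- Every finitely generated group that is linear over a field of positive characteristic p (i.e., embeds in GL_d(K) for some field K of characteristic p) has at most exponential residual girth: there exists C > 1 such that for every n, there is a normal subgroup of index at most C^n intersecting the ball of radius n (with respect to a fixed finite generating set) only in the identity. -/
open Pointwise

/-- The residual girth of a group `Γ` with generating set `S` at `n`: the smallest index of a
finite-index normal subgroup meeting the `n`-ball `S^n` only in the identity (`⊤ : ℕ∞` if no
such subgroup exists). -/
noncomputable def residualGirth {Γ : Type*} [Group Γ] (S : Set Γ) (n : ℕ) : ℕ∞ :=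
  sInf {c : ℕ∞ | ∃ H : Subgroup Γ, H.Normal ∧ H.index ≠ 0 ∧ (H.index : ℕ∞) = c ∧
    ∀ g ∈ H, g ∈ S ^ n → g = 1}

namespace ResidualGirth

open MvPolynomial

section CoefficientDegree

variable {σ k : Type*} [CommRing k]

/-- All coefficients of `f` have total degree at most `n`. -/
def CoeffDegLE (n : ℕ) (f : Polynomial (MvPolynomial σ k)) : Prop :=
  ∀ i, (f.coeff i).totalDegree ≤ n

lemma CoeffDegLE.mul {m n : ℕ} {f g : Polynomial (MvPolynomial σ k)}
    (hf : CoeffDegLE m f) (hg : CoeffDegLE n g) : CoeffDegLE (m + n) (f * g) := by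
  intro i
  rw [Polynomial.coeff_mul]
  exact totalDegree_finsetSum_le fun x _ =>
    (totalDegree_mul _ _).trans (Nat.add_le_add (hf _) (hg _))

lemma CoeffDegLE.prod {ι : Type*} {n : ℕ} (s : Finset ι) {f : ι → Polynomial (MvPolynomial σ k)}
    (hf : ∀ i ∈ s, CoeffDegLE n (f i)) : CoeffDegLE (s.card * n) (∏ i ∈ s, f i) := by
  classical
  induction s using Finset.induction_on with
  | empty =>
    intro i
    rw [Finset.prod_empty, Polynomial.coeff_one]
    split_ifs <;> simp
  | insert a s ha ih =>
    rw [Finset.prod_insert ha, Finset.card_insert_of_notMem ha, add_mul, one_mul, add_comm]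
    exact (hf a (by simp)).mul (ih fun i hi => hf i (by simp [hi]))

lemma coeffDegLE_charpoly {r n : ℕ} (M : Matrix (Fin r) (Fin r) (MvPolynomial σ k))
    (hM : ∀ i j, (M i j).totalDegree ≤ n) : CoeffDegLE (r * n) M.charpoly := by
  have hchar : ∀ i j, CoeffDegLE n (M.charmatrix i j) := by
    intro i j m
    rw [Matrix.charmatrix_apply, Polynomial.coeff_sub, Matrix.diagonal_apply, Polynomial.coeff_C]
    refine (totalDegree_sub _ _).trans (max_le ?_ ?_)
    · split_ifs
      · rw [Polynomial.coeff_X]; split_ifs <;> simp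
      · simp
    · split_ifs
      · exact hM i j
      · simp
  intro i
  rw [Matrix.charpoly, Matrix.det_apply, Polynomial.finsetSum_coeff]
  refine totalDegree_finsetSum_le fun τ _ => ?_
  have h := CoeffDegLE.prod Finset.univ (fun j _ => hchar (τ j) j) i
  rw [Finset.card_univ, Fintype.card_fin] at h
  rcases Int.units_eq_one_or (Equiv.Perm.sign τ) with hs | hs
  · simpa [hs] using h
  · simpa [hs, totalDegree_neg] using h

end CoefficientDegree

section Filtration

variable {s r : ℕ} {k A : Type*} [Field k] [CommRing A] [Algebra (MvPolynomial (Fin s) k) A]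

/-- Multiplication by `a` on the family `e` is represented by a matrix of polynomials of total
degree at most `n`. -/
def DegLE (e : Fin r → A) (n : ℕ) (a : A) : Prop :=
  ∃ M : Matrix (Fin r) (Fin r) (MvPolynomial (Fin s) k),
    (∀ i j, (M i j).totalDegree ≤ n) ∧
      (M.map (algebraMap (MvPolynomial (Fin s) k) A)).mulVec e = a • e

variable {e : Fin r → A}

lemma DegLE.mono {m n : ℕ} (h : m ≤ n) {a : A} (ha : DegLE (k := k) (s := s) e m a) :
    DegLE (k := k) (s := s) e n a := by
  obtain ⟨M, hM, he⟩ := ha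
  exact ⟨M, fun i j => (hM i j).trans h, he⟩

lemma DegLE.zero (n : ℕ) : DegLE (k := k) (s := s) e n 0 :=
  ⟨0, by simp, by ext; simp [Matrix.mulVec, dotProduct]⟩

lemma DegLE.one (n : ℕ) : DegLE (k := k) (s := s) e n 1 :=
  ⟨1, fun i j => by rw [Matrix.one_apply]; split_ifs <;> simp, by simp⟩

lemma DegLE.add {n : ℕ} {a b : A} (ha : DegLE (k := k) (s := s) e n a)
    (hb : DegLE (k := k) (s := s) e n b) : DegLE (k := k) (s := s) e n (a + b) := by
  obtain ⟨M, hM, he⟩ := ha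
  obtain ⟨N, hN, hf⟩ := hb
  refine ⟨M + N, fun i j => (totalDegree_add _ _).trans (max_le (hM i j) (hN i j)), ?_⟩
  rw [Matrix.map_add _ (map_add _), Matrix.add_mulVec, he, hf, add_smul]

lemma DegLE.sub {n : ℕ} {a b : A} (ha : DegLE (k := k) (s := s) e n a)
    (hb : DegLE (k := k) (s := s) e n b) : DegLE (k := k) (s := s) e n (a - b) := by
  obtain ⟨M, hM, he⟩ := ha
  obtain ⟨N, hN, hf⟩ := hb
  refine ⟨M - N, fun i j => (totalDegree_sub _ _).trans (max_le (hM i j) (hN i j)), ?_⟩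
  rw [Matrix.map_sub _ (map_sub _), Matrix.sub_mulVec, he, hf, sub_smul]

lemma DegLE.mul {m n : ℕ} {a b : A} (ha : DegLE (k := k) (s := s) e m a)
    (hb : DegLE (k := k) (s := s) e n b) : DegLE (k := k) (s := s) e (m + n) (a * b) := by
  obtain ⟨M, hM, he⟩ := ha
  obtain ⟨N, hN, hf⟩ := hb
  refine ⟨M * N, fun i j => ?_, ?_⟩
  · rw [Matrix.mul_apply]
    exact totalDegree_finsetSum_le fun l _ =>
      (totalDegree_mul _ _).trans (Nat.add_le_add (hM _ _) (hN _ _))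
  · rw [Matrix.map_mul, ← Matrix.mulVec_mulVec, hf, Matrix.mulVec_smul, he, smul_smul, mul_comm]

lemma DegLE.sum {ι : Type*} {n : ℕ} (t : Finset ι) {f : ι → A}
    (hf : ∀ i ∈ t, DegLE (k := k) (s := s) e n (f i)) :
    DegLE (k := k) (s := s) e n (∑ i ∈ t, f i) :=
  Finset.sum_induction f _ (fun _ _ => DegLE.add) (DegLE.zero n) hf

lemma exists_degLE (he : Submodule.span (MvPolynomial (Fin s) k) (Set.range e) = ⊤) (a : A) :
    ∃ n, DegLE (k := k) (s := s) e n a := by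
  have h : ∀ i, ∃ c : Fin r → MvPolynomial (Fin s) k, ∑ j, c j • e j = a * e i := fun i =>
    (Submodule.mem_span_range_iff_exists_fun _).1 (he ▸ Submodule.mem_top)
  choose c hc using h
  refine ⟨Finset.univ.sup fun x : Fin r × Fin r => (c x.1 x.2).totalDegree, Matrix.of c,
    fun i j => ?_, ?_⟩
  · exact Finset.le_sup (f := fun x : Fin r × Fin r => (c x.1 x.2).totalDegree)
      (Finset.mem_univ (i, j))
  · ext i
    simp [Matrix.mulVec, dotProduct, ← hc i, Algebra.smul_def]

/-- A nonzero element of bounded degree divides a nonzero polynomial of bounded degree. -/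
lemma DegLE.exists_dvd_algebraMap [IsDomain A]
    (he : Submodule.span (MvPolynomial (Fin s) k) (Set.range e) = ⊤) {n : ℕ} {a : A}
    (ha : DegLE (k := k) (s := s) e n a) (ha0 : a ≠ 0) :
    ∃ c : MvPolynomial (Fin s) k, c ≠ 0 ∧ c.totalDegree ≤ r * n ∧
      a ∣ algebraMap (MvPolynomial (Fin s) k) A c := by
  obtain ⟨M, hM, hMe⟩ := ha
  have he0 : e ≠ 0 := by
    rintro rfl
    have h1 : (1 : A) ∈ Submodule.span (MvPolynomial (Fin s) k) (Set.range (0 : Fin r → A)) :=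
      he ▸ Submodule.mem_top
    obtain ⟨c, hc⟩ := (Submodule.mem_span_range_iff_exists_fun _).1 h1
    simp at hc
  have hroot : M.charpoly.eval₂ (algebraMap _ A) a = 0 := by
    rw [← Polynomial.eval_map, ← Matrix.charpoly_map, Matrix.eval_charpoly]
    refine Matrix.exists_mulVec_eq_zero_iff.1 ⟨e, he0, ?_⟩
    rw [Matrix.sub_mulVec, hMe, sub_eq_zero]
    ext i
    simp [Matrix.mulVec_diagonal]
  obtain ⟨i, hi, hmem⟩ := Ideal.exists_coeff_ne_zero_mem_comap_of_root_mem ha0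
    (Ideal.mem_span_singleton_self a) (Matrix.charpoly_monic M).ne_zero hroot
  exact ⟨_, hi, coeffDegLE_charpoly M hM i, Ideal.mem_span_singleton.1 hmem⟩

/-- Finitely many nonzero elements of bounded degree survive in a small finite quotient. -/
lemma exists_ideal_card_quotient_le [IsDomain A]
    (hinj : Function.Injective (algebraMap (MvPolynomial (Fin s) k) A))
    (he : Submodule.span (MvPolynomial (Fin s) k) (Set.range e) = ⊤)
    (F : Type*) [Field F] [Finite F] [Algebra k F] {n : ℕ} (X : Finset A)
    (hX : ∀ a ∈ X, DegLE (k := k) (s := s) e n a ∧ a ≠ 0)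
    (hcard : X.card * (r * n) < Nat.card F) :
    ∃ I : Ideal A, Finite (A ⧸ I) ∧ Nat.card (A ⧸ I) ≤ Nat.card F ^ r ∧ ∀ a ∈ X, a ∉ I := by
  classical
  have := Fintype.ofFinite F
  have hdvd : ∀ a : X, ∃ c : MvPolynomial (Fin s) k, c ≠ 0 ∧ c.totalDegree ≤ r * n ∧
      (a : A) ∣ algebraMap (MvPolynomial (Fin s) k) A c := fun a =>
    (hX a a.2).1.exists_dvd_algebraMap he (hX a a.2).2
  choose c hc0 hcdeg hcdvd using hdvd
  let Q : MvPolynomial (Fin s) k := ∏ a : X, c a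
  have hQ0 : Q ≠ 0 := Finset.prod_ne_zero_iff.2 fun a _ => hc0 a
  have hQdeg : Q.totalDegree < Fintype.card F := by
    rw [← Nat.card_eq_fintype_card]
    refine lt_of_le_of_lt ((totalDegree_finsetProd _ _).trans ?_) hcard
    simpa using Finset.sum_le_card_nsmul Finset.univ _ _ fun a _ => hcdeg a
  obtain ⟨x, hx⟩ : ∃ x : Fin s → F, aeval x Q ≠ 0 := by
    by_contra! h
    refine hQ0 (map_injective _ (algebraMap k F).injective ?_)
    rw [map_zero]
    refine eq_zero_of_eval_zero_at_prod_finset _ (fun _ => Finset.univ) (fun i => ?_) fun x _ => ?_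
    · rw [Finset.card_univ]
      exact ((degreeOf_le_totalDegree _ i).trans
        (Finset.sup_mono (support_map_subset _ _))).trans_lt hQdeg
    · rw [eval_map, ← aeval_def]
      exact h x
  let ψ : MvPolynomial (Fin s) k →+* F := (aeval x : _ →ₐ[k] F).toRingHom
  have hprime : (RingHom.ker ψ).IsPrime := RingHom.ker_isPrime ψ
  have : Module.Finite (MvPolynomial (Fin s) k) A :=
    ⟨⟨(Set.finite_range e).toFinset, by simpa using he⟩⟩
  obtain ⟨I, _, hI⟩ := Ideal.exists_ideal_over_prime_of_isIntegral_of_isDomain (S := A)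
    (RingHom.ker ψ) (by
      rw [(RingHom.injective_iff_ker_eq_bot _).1 hinj]
      exact bot_le)
  let f : (Fin r → F) → A ⧸ I := fun v =>
    Ideal.Quotient.mk I (∑ i, algebraMap (MvPolynomial (Fin s) k) A (Function.invFun ψ (v i)) * e i)
  have hf : Function.Surjective f := by
    intro y
    obtain ⟨a, rfl⟩ := Ideal.Quotient.mk_surjective y
    obtain ⟨q, rfl⟩ := (Submodule.mem_span_range_iff_exists_fun _).1
      (he ▸ Submodule.mem_top : a ∈ Submodule.span (MvPolynomial (Fin s) k) (Set.range e))
    refine ⟨fun i => ψ (q i), ?_⟩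
    simp only [f, map_sum, map_mul, Algebra.smul_def]
    refine Finset.sum_congr rfl fun i _ => ?_
    congr 1
    rw [Ideal.Quotient.mk_eq_mk_iff_sub_mem, ← map_sub, ← Ideal.mem_comap, hI, RingHom.mem_ker,
      map_sub, sub_eq_zero]
    exact Function.invFun_eq ⟨q i, rfl⟩
  refine ⟨I, Finite.of_surjective f hf, ?_, fun a ha haI => hx ?_⟩
  · simpa using Nat.card_le_card_of_surjective f hf
  · have hmem : c ⟨a, ha⟩ ∈ RingHom.ker ψ := by
      rw [← hI, Ideal.mem_comap]
      exact I.mem_of_dvd (hcdvd ⟨a, ha⟩) haI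
    exact Ideal.mem_of_dvd (RingHom.ker ψ) (Finset.dvd_prod_of_mem c (Finset.mem_univ _)) hmem

end Filtration

section Group

variable {Γ : Type*} [Group Γ]

/-- A representation whose values on generators have entries in a subring has all its values in
matrices over that subring. -/
lemma exists_restrict_matrix {R K : Type*} [CommSemiring R] [Field K] [Algebra R K] {d : ℕ}
    {S : Finset Γ} (hsym : ∀ g ∈ S, g⁻¹ ∈ S) (hgen : Subgroup.closure (S : Set Γ) = ⊤)
    (φ : Γ →* Matrix.GeneralLinearGroup (Fin d) K) (A : Subalgebra R K)
    (hA : ∀ g ∈ S, ∀ i j, φ g i j ∈ A) :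
    ∃ ρ : Γ →* Matrix (Fin d) (Fin d) A, ∀ g i j, (ρ g i j : K) = φ g i j := by
  have hone : ∀ i j, (1 : Matrix (Fin d) (Fin d) K) i j ∈ A := fun i j => by
    rw [Matrix.one_apply]
    split_ifs
    exacts [A.one_mem, A.zero_mem]
  have hmul : ∀ M N : Matrix (Fin d) (Fin d) K, (∀ i j, M i j ∈ A) → (∀ i j, N i j ∈ A) →
      ∀ i j, (M * N) i j ∈ A := fun M N hM hN i j => by
    rw [Matrix.mul_apply]
    exact A.sum_mem fun l _ => A.mul_mem (hM _ _) (hN _ _)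
  have hmem : ∀ g, (∀ i j, φ g i j ∈ A) ∧ ∀ i j, φ g⁻¹ i j ∈ A := by
    intro g
    have hg : g ∈ Subgroup.closure (S : Set Γ) := hgen ▸ Subgroup.mem_top g
    induction hg using Subgroup.closure_induction with
    | mem x hx => exact ⟨hA x hx, hA _ (hsym x hx)⟩
    | one => simpa using hone
    | mul x y _ _ hx hy =>
      rw [mul_inv_rev, map_mul, map_mul]
      exact ⟨hmul _ _ hx.1 hy.1, hmul _ _ hy.2 hx.2⟩
    | inv x _ hx => exact ⟨hx.2, by simpa using hx.1⟩
  refine ⟨⟨⟨fun g => Matrix.of fun i j => ⟨φ g i j, (hmem g).1 i j⟩, ?_⟩, ?_⟩, fun g i j => rfl⟩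
  · ext i j
    simp only [map_one, Matrix.of_apply, Units.val_one, Matrix.one_apply]
    split_ifs <;> rfl
  · intro g h
    ext i j
    simp [Matrix.mul_apply]

/-- The kernel of a matrix representation reduced modulo an ideal with finite quotient. -/
lemma exists_normal_index_le {A : Type*} [CommRing A] {d : ℕ}
    (ρ : Γ →* Matrix (Fin d) (Fin d) A) (I : Ideal A) [Finite (A ⧸ I)] :
    ∃ H : Subgroup Γ, H.Normal ∧ H.index ≠ 0 ∧ H.index ≤ Nat.card (A ⧸ I) ^ (d * d) ∧
      ∀ g ∈ H, ∀ i j, (ρ g - 1) i j ∈ I := by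
  let π : Γ →* Matrix (Fin d) (Fin d) (A ⧸ I) :=
    ((Ideal.Quotient.mk I).mapMatrix.toMonoidHom).comp ρ
  refine ⟨π.toHomUnits.ker, inferInstance, ?_, ?_, fun g hg i j => ?_⟩
  · rw [Subgroup.index_ker]
    exact Nat.card_pos.ne'
  · rw [Subgroup.index_ker]
    calc Nat.card π.toHomUnits.range ≤ Nat.card (Matrix (Fin d) (Fin d) (A ⧸ I)) :=
          Nat.card_le_card_of_injective (Units.val ∘ Subtype.val)
            (Units.val_injective.comp Subtype.val_injective)
      _ = Nat.card (A ⧸ I) ^ (d * d) := by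
          simp [Matrix, Nat.card_fun, pow_mul]
  · have h : π g = 1 := by simpa using congrArg Units.val hg
    rw [← Ideal.Quotient.eq_zero_iff_mem]
    have h2 : (Ideal.Quotient.mk I).mapMatrix (ρ g - 1) = 0 := by
      rw [map_sub, map_one, sub_eq_zero]
      exact h
    exact congrFun (congrFun h2 i) j

lemma degLE_of_mem_pow {s r d D : ℕ} {k A : Type*} [Field k] [CommRing A]
    [Algebra (MvPolynomial (Fin s) k) A] {e : Fin r → A} {S : Set Γ}
    (ρ : Γ →* Matrix (Fin d) (Fin d) A)
    (hD : ∀ g ∈ S, ∀ i j, DegLE (k := k) (s := s) e D (ρ g i j)) (n : ℕ) :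
    ∀ g ∈ S ^ n, ∀ i j, DegLE (k := k) (s := s) e (n * D) (ρ g i j) := by
  induction n with
  | zero =>
    intro g hg i j
    rw [pow_zero, Set.mem_one] at hg
    rw [hg, map_one, Matrix.one_apply]
    split_ifs
    exacts [DegLE.one _, DegLE.zero _]
  | succ n ih =>
    intro g hg i j
    rw [pow_succ] at hg
    obtain ⟨a, ha, b, hb, rfl⟩ := Set.mem_mul.1 hg
    rw [map_mul, Matrix.mul_apply, add_mul, one_mul]
    exact DegLE.sum _ fun l _ => (ih a ha i l).mul (hD b hb l j)

/-- A group with a faithful representation over a finitely generated domain of positive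
characteristic has at most exponential residual girth. -/
lemma exists_residualGirth_le_pow (S : Finset Γ) {p d : ℕ} [Fact p.Prime] {A : Type*}
    [CommRing A] [IsDomain A] [Algebra (ZMod p) A] [Algebra.FiniteType (ZMod p) A]
    (ρ : Γ →* Matrix (Fin d) (Fin d) A) (hρ : Function.Injective ρ) :
    ∃ C : ℕ, 1 < C ∧ ∀ n : ℕ, residualGirth (S : Set Γ) n ≤ ((C ^ n : ℕ) : ℕ∞) := by
  classical
  obtain ⟨s, g, hinj, hfin⟩ := exists_finite_inj_algHom_of_fg (ZMod p) A
  let : Algebra (MvPolynomial (Fin s) (ZMod p)) A := g.toRingHom.toAlgebra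
  have : Module.Finite (MvPolynomial (Fin s) (ZMod p)) A := hfin
  obtain ⟨r, e, he⟩ := Module.Finite.exists_fin (R := MvPolynomial (Fin s) (ZMod p)) (M := A)
  choose deg hdeg using exists_degLE he
  let D := S.sup fun g => Finset.univ.sup fun x : Fin d × Fin d => deg (ρ g x.1 x.2)
  have hD : ∀ g ∈ (S : Set Γ), ∀ i j, DegLE (k := ZMod p) (s := s) e D (ρ g i j) := by
    intro g hg i j
    refine (hdeg _).mono ((Finset.le_sup (f := fun x : Fin d × Fin d => deg (ρ g x.1 x.2))
      (Finset.mem_univ (i, j))).trans ?_)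
    exact Finset.le_sup (f := fun g => Finset.univ.sup fun x : Fin d × Fin d =>
      deg (ρ g x.1 x.2)) hg
  let B := (S.card + 1) * (d * d + 1) * (r + 1) * (D + 1)
  have hp : 1 < p := (Fact.out : p.Prime).one_lt
  let E := 2 * B
  have hB : ∀ n, n ≠ 0 → S.card ^ n * (d * d) * (r * (n * D)) < p ^ (E * n) := by
    intro n hn
    have hn' : n < p ^ n := Nat.lt_pow_self hp
    have hBp : B < p ^ B := Nat.lt_pow_self hp
    have h1 : S.card ^ n ≤ (S.card + 1) ^ n := Nat.pow_le_pow_left (by omega) n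
    have h2 : ∀ m, m ≤ (m + 1) ^ n := fun m =>
      (Nat.le_succ m).trans (Nat.le_self_pow hn _)
    calc S.card ^ n * (d * d) * (r * (n * D))
        ≤ (S.card + 1) ^ n * (d * d + 1) ^ n * ((r + 1) ^ n * (n * (D + 1) ^ n)) := by
          gcongr
          · exact h2 _
          · exact h2 _
          · exact h2 _
      _ = B ^ n * n := by simp only [B, mul_pow]; ring
      _ < B ^ n * p ^ n := Nat.mul_lt_mul_of_pos_left hn' (by positivity)
      _ ≤ (p ^ B) ^ n * (p ^ B) ^ n := by
          gcongr
          exact Nat.le_self_pow (by positivity) p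
      _ = p ^ (E * n) := by simp only [E, ← pow_mul, ← pow_add]; congr 1; ring
  refine ⟨p ^ (E * r * (d * d) + 1), Nat.one_lt_pow (by omega) hp, fun n => ?_⟩
  rcases eq_or_ne n 0 with rfl | hn
  · refine sInf_le_of_le ⟨⊤, inferInstance, by simp, rfl, fun g _ hg => ?_⟩ (by simp)
    simpa using hg
  have hball := degLE_of_mem_pow ρ hD n
  let X : Finset A := (((S ^ n) ×ˢ (Finset.univ : Finset (Fin d × Fin d))).image
    fun x => (ρ x.1 - 1) x.2.1 x.2.2).filter (· ≠ 0)
  have hX : ∀ a ∈ X, DegLE (k := ZMod p) (s := s) e (n * D) a ∧ a ≠ 0 := by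
    intro a ha
    obtain ⟨ha, ha0⟩ := Finset.mem_filter.1 ha
    obtain ⟨⟨g, i, j⟩, hg, rfl⟩ := Finset.mem_image.1 ha
    have hg' : g ∈ (S : Set Γ) ^ n := by
      rw [← Finset.coe_pow]
      exact (Finset.mem_product.1 hg).1
    refine ⟨(hball g hg' i j).sub ?_, ha0⟩
    rw [Matrix.one_apply]
    split_ifs
    exacts [DegLE.one _, DegLE.zero _]
  have hXcard : X.card ≤ S.card ^ n * (d * d) := by
    refine (Finset.card_filter_le _ _).trans (Finset.card_image_le.trans ?_)
    rw [Finset.card_product]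
    simpa using Nat.mul_le_mul_right _ Finset.card_pow_le
  have hF : Nat.card (GaloisField p (E * n)) = p ^ (E * n) :=
    GaloisField.card p _ (by positivity)
  obtain ⟨I, hfinI, hI, hXI⟩ := exists_ideal_card_quotient_le (k := ZMod p) (s := s) hinj he
    (GaloisField p (E * n)) X hX (by
      rw [hF]
      exact (Nat.mul_le_mul_right _ hXcard).trans_lt (hB n hn))
  obtain ⟨H, hnormal, hindex, hle, hH⟩ := exists_normal_index_le ρ I
  refine sInf_le_of_le ⟨H, hnormal, hindex, rfl, fun g hg hgn => ?_⟩ (Nat.cast_le.2 ?_)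
  · by_contra hg1
    obtain ⟨i, j, hij⟩ : ∃ i j, (ρ g - 1) i j ≠ 0 := by
      by_contra! h
      refine hg1 (hρ ?_)
      rw [map_one, ← sub_eq_zero]
      ext i j
      exact h i j
    refine hXI _ (Finset.mem_filter.2 ⟨Finset.mem_image.2 ⟨(g, i, j), ?_, rfl⟩, hij⟩) (hH g hg i j)
    rw [← Finset.coe_pow] at hgn
    exact Finset.mem_product.2 ⟨hgn, Finset.mem_univ _⟩
  · calc H.index ≤ ((p ^ (E * n)) ^ r) ^ (d * d) :=
          hle.trans (Nat.pow_le_pow_left (hF ▸ hI) _)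
      _ = p ^ (E * r * (d * d) * n) := by simp only [← pow_mul]; congr 1; ring
      _ ≤ (p ^ (E * r * (d * d) + 1)) ^ n := by
          rw [← pow_mul]
          exact Nat.pow_le_pow_right (by omega) (Nat.mul_le_mul_right _ (Nat.le_succ _))

end Group

end ResidualGirth

/-- Every finitely generated group that is linear over a field of positive characteristic `p`
has at most exponential residual girth. -/
theorem residualGirth_le_exponential_of_linear_charP (Γ : Type) [Group Γ]
    (S : Finset Γ) (hsym : ∀ g ∈ S, g⁻¹ ∈ S) (hone : (1 : Γ) ∈ S)
    (hgen : Subgroup.closure (S : Set Γ) = ⊤)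
    (d p : ℕ) (hp : p.Prime) (K : Type) [Field K] [CharP K p]
    (φ : Γ →* Matrix.GeneralLinearGroup (Fin d) K) (hφ : Function.Injective φ) :
    ∃ C : ℕ, 1 < C ∧ ∀ n : ℕ, residualGirth (S : Set Γ) n ≤ ((C ^ n : ℕ) : ℕ∞) := by
  classical
  have : Fact p.Prime := ⟨hp⟩
  let : Algebra (ZMod p) K := ZMod.algebra K p
  let T : Finset K := (S ×ˢ (Finset.univ : Finset (Fin d × Fin d))).image
    fun x => φ x.1 x.2.1 x.2.2
  let A := Algebra.adjoin (ZMod p) (T : Set K)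
  have : Algebra.FiniteType (ZMod p) A :=
    (Subalgebra.fg_iff_finiteType A).1 (Subalgebra.fg_adjoin_finset T)
  obtain ⟨ρ, hρ⟩ := ResidualGirth.exists_restrict_matrix hsym hgen φ A fun g hg i j =>
    Algebra.subset_adjoin (Finset.mem_coe.2 (Finset.mem_image.2
      ⟨(g, i, j), Finset.mem_product.2 ⟨hg, Finset.mem_univ _⟩, rfl⟩))
  refine ResidualGirth.exists_residualGirth_le_pow S (p := p) ρ fun g h hgh => hφ ?_
  ext i j
  rw [← hρ, ← hρ, hgh]
end

section
/- Every finitely generated group that is linear over a field of characteristic 0 has at most exponential residual girth. -/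
open Pointwise

/-- A function `ℕ → ℕ` that is bounded by some exponential function on positive integers. -/
def ExpBounded (f : ℕ → ℕ) : Prop := ∃ C : ℕ, ∀ n, 1 ≤ n → f n ≤ C ^ n

namespace ExpBounded

variable {f g : ℕ → ℕ}

theorem const (c : ℕ) : ExpBounded fun _ => c :=
  ⟨c, fun _ hn => Nat.le_self_pow (by omega) c⟩

theorem self : ExpBounded fun n => n := ⟨2, fun _ _ => Nat.lt_two_pow_self.le⟩

theorem pow_self (c : ℕ) : ExpBounded fun n => c ^ n := ⟨c, fun _ _ => le_rfl⟩

theorem mul (hf : ExpBounded f) (hg : ExpBounded g) : ExpBounded fun n => f n * g n := by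
  obtain ⟨C, hC⟩ := hf
  obtain ⟨D, hD⟩ := hg
  exact ⟨C * D, fun n hn => (Nat.mul_le_mul (hC n hn) (hD n hn)).trans_eq (mul_pow C D n).symm⟩

theorem add (hf : ExpBounded f) (hg : ExpBounded g) : ExpBounded fun n => f n + g n := by
  obtain ⟨C, hC⟩ := hf
  obtain ⟨D, hD⟩ := hg
  exact ⟨C + D, fun n hn => (Nat.add_le_add (hC n hn) (hD n hn)).trans
    (pow_add_pow_le (by positivity) (by positivity) (by omega))⟩

theorem pow (hf : ExpBounded f) (k : ℕ) : ExpBounded fun n => f n ^ k := by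
  obtain ⟨C, hC⟩ := hf
  exact ⟨C ^ k, fun n hn => (Nat.pow_le_pow_left (hC n hn) k).trans_eq (by ring)⟩

end ExpBounded

/-- A nonzero natural number below `2 ^ L` is prime to some prime that is at most `16 * L ^ 2`. -/
theorem exists_prime_le_not_dvd {M L : ℕ} (hM : M ≠ 0) (hL : M < 2 ^ L) :
    ∃ p, p.Prime ∧ p ≤ 16 * L ^ 2 ∧ ¬ p ∣ M := by
  by_contra! h
  have hL0 : 0 < L := Nat.pos_of_ne_zero (by rintro rfl; simp at hL; omega)
  set n := 16 * L ^ 2 with hn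
  have hsub : Nat.primesLE n ⊆ M.primeFactors := fun p hp => by
    have := Nat.mem_primesLE.1 hp
    exact Nat.mem_primeFactors.2 ⟨this.2, h p this.2 this.1, hM⟩
  have hcard : (Nat.primesLE n).card < L := by
    have h1 : 2 ^ M.primeFactors.card ≤ M :=
      (Finset.pow_card_le_prod _ _ _ fun p hp => (Nat.prime_of_mem_primeFactors hp).two_le).trans
        (Nat.le_of_dvd (by omega) (Nat.prod_primeFactors_dvd M))
    have h2 := (Nat.pow_lt_pow_iff_right (by norm_num : 1 < 2)).1 (h1.trans_lt hL)
    exact (Finset.card_le_card hsub).trans_lt h2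
  have hlcm : Nat.lcmUpto n ≤ n ^ (Nat.primesLE n).card := by
    rw [Nat.lcmUpto_eq_prod_pow_log]
    exact Finset.prod_le_pow_card _ _ _ fun p _ => Nat.pow_log_le_self p (by positivity)
  have h3 : 2 ^ n ≤ (n + 1) ^ L := calc
    2 ^ n ≤ (n + 1) * Nat.lcmUpto n := Chebyshev.two_pow_le_mul_lcmUpto n
    _ ≤ (n + 1) * (n + 1) ^ (Nat.primesLE n).card := by
      gcongr
      exact hlcm.trans (Nat.pow_le_pow_left (by omega) _)
    _ = (n + 1) ^ ((Nat.primesLE n).card + 1) := by ring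
    _ ≤ (n + 1) ^ L := Nat.pow_le_pow_right (by omega) hcard
  have h4 : n + 1 < 2 ^ (16 * L) := by
    have h5 : L < 2 ^ L := Nat.lt_two_pow_self
    have h6 : 2 ^ 14 ≤ 2 ^ (14 * L) := Nat.pow_le_pow_right (by norm_num) (by omega)
    have h7 : L ^ 2 < 2 ^ (2 * L) := by
      rw [mul_comm, pow_mul]; exact Nat.pow_lt_pow_left h5 (by norm_num)
    calc n + 1 ≤ 17 * 2 ^ (2 * L) := by omega
      _ < 2 ^ (14 * L) * 2 ^ (2 * L) := by gcongr; omega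
      _ = 2 ^ (16 * L) := by ring
  have h8 : (n + 1) ^ L < 2 ^ n := calc
    (n + 1) ^ L < (2 ^ (16 * L)) ^ L := Nat.pow_lt_pow_left h4 (by omega)
    _ = 2 ^ n := by rw [← pow_mul, hn]; ring_nf
  omega

namespace MvPolynomial

variable {σ : Type*}

theorem exists_abs_eval_le (P : MvPolynomial σ ℤ) :
    ∃ c : ℕ, ∀ T : ℤ, 1 ≤ T → ∀ a : σ → ℤ, (∀ i, |a i| ≤ T) → |eval a P| ≤ (T + 1) ^ c := by
  induction P using MvPolynomial.induction_on with
  | C r =>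
    refine ⟨r.natAbs, fun T hT a _ => ?_⟩
    have h1 : (r.natAbs : ℤ) < 2 ^ r.natAbs := by exact_mod_cast Nat.lt_two_pow_self
    rw [eval_C, Int.abs_eq_natAbs]
    exact h1.le.trans (pow_le_pow_left₀ (by norm_num) (by omega) _)
  | add p q hp hq =>
    obtain ⟨c, hc⟩ := hp
    obtain ⟨d, hd⟩ := hq
    refine ⟨max c d + 1, fun T hT a ha => ?_⟩
    have h1 : (T + 1) ^ c ≤ (T + 1) ^ max c d :=
      pow_le_pow_right₀ (by omega) (le_max_left _ _)
    have h2 : (T + 1) ^ d ≤ (T + 1) ^ max c d :=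
      pow_le_pow_right₀ (by omega) (le_max_right _ _)
    have h3 : 0 ≤ (T + 1) ^ max c d := by positivity
    rw [eval_add, pow_succ]
    nlinarith [abs_add_le (eval a p) (eval a q), hc T hT a ha, hd T hT a ha]
  | mul_X p i hp =>
    obtain ⟨c, hc⟩ := hp
    refine ⟨c + 1, fun T hT a ha => ?_⟩
    rw [eval_mul, eval_X, abs_mul, pow_succ]
    gcongr
    · exact hc T hT a ha
    · linarith [ha i]

theorem exists_eval_ne_zero_of_totalDegree_le [Finite σ] {F : MvPolynomial σ ℤ} (hF : F ≠ 0)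
    {D : ℕ} (hD : F.totalDegree ≤ D) : ∃ a : σ → ℤ, (∀ i, |a i| ≤ D) ∧ eval a F ≠ 0 := by
  by_contra! h
  refine hF (eq_zero_of_eval_zero_at_prod_finset F (fun _ => Finset.Icc 0 (D : ℤ))
    (fun i => ?_) fun x hx => h x fun i => ?_)
  · have := degreeOf_le_totalDegree F i
    simp
    omega
  · have := Finset.mem_Icc.1 (hx i)
    rw [abs_of_nonneg this.1]
    exact this.2

end MvPolynomial

namespace Matrix

variable {ι : Type*} [Fintype ι] [DecidableEq ι]

theorem totalDegree_list_prod_apply_le {σ R : Type*} [CommSemiring R] {k : ℕ}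
    (l : List (Matrix ι ι (MvPolynomial σ R)))
    (hl : ∀ M ∈ l, ∀ i j, (M i j).totalDegree ≤ k) (i j : ι) :
    (l.prod i j).totalDegree ≤ l.length * k := by
  induction l generalizing i with
  | nil =>
    rw [List.prod_nil, one_apply]
    split_ifs <;> simp
  | cons M l ih =>
    rw [List.prod_cons, mul_apply]
    refine MvPolynomial.totalDegree_finsetSum_le fun x _ =>
      (MvPolynomial.totalDegree_mul _ _).trans ?_
    have h1 := hl M (by simp) i x
    have h2 := ih (fun M hM => hl M (by simp [hM])) x
    rw [List.length_cons, add_mul]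
    omega

theorem abs_list_prod_apply_le {b : ℤ} (hb : 0 ≤ b) (l : List (Matrix ι ι ℤ))
    (hl : ∀ M ∈ l, ∀ i j, |M i j| ≤ b) (i j : ι) :
    |l.prod i j| ≤ (Fintype.card ι * b) ^ l.length := by
  induction l generalizing i with
  | nil =>
    rw [List.prod_nil, one_apply]
    split_ifs <;> simp
  | cons M l ih =>
    rw [List.prod_cons, mul_apply, List.length_cons, pow_succ']
    calc |∑ x, M i x * l.prod x j| ≤ ∑ x, |M i x * l.prod x j| := Finset.abs_sum_le_sum_abs _ _
      _ ≤ ∑ _x : ι, b * (Fintype.card ι * b) ^ l.length := by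
        refine Finset.sum_le_sum fun x _ => ?_
        rw [abs_mul]
        exact mul_le_mul (hl M (by simp) i x) (ih (fun M hM => hl M (by simp [hM])) x)
          (abs_nonneg _) hb
      _ = _ := by simp; ring

end Matrix

/-- A monoid homomorphism factors through an injective one as soon as the images of a
generating set do. -/
theorem MonoidHom.exists_comp_eq_of_closure_eq_top {G M M' : Type*} [Monoid G] [Monoid M]
    [Monoid M'] {S : Set G} (hS : Submonoid.closure S = ⊤) (j : M →* M')
    (hj : Function.Injective j) (ρ : G →* M') (h : ∀ s ∈ S, ρ s ∈ MonoidHom.mrange j) :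
    ∃ ρ' : G →* M, j.comp ρ' = ρ := by
  have hmem : ∀ g, ∃ x, j x = ρ g := fun g => by
    have : Submonoid.closure S ≤ (MonoidHom.mrange j).comap ρ := Submonoid.closure_le.2 h
    exact this (hS ▸ Submonoid.mem_top g)
  choose f hf using hmem
  exact ⟨⟨⟨f, hj (by simp [hf])⟩, fun x y => hj (by simp [hf])⟩, MonoidHom.ext hf⟩

open MvPolynomial in
/-- A product of finitely many nonzero integer polynomials, each of degree at most `δ` and of
absolute value at most `B` at every point of the cube `[-D, D]^σ`, is nonzero modulo a small prime
at some point of this cube. -/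
theorem exists_prime_not_dvd_eval {σ κ : Type*} [Finite σ] [Fintype κ]
    (f : κ → MvPolynomial σ ℤ) (hf : ∀ w, f w ≠ 0) {δ D L : ℕ} {B : ℤ}
    (hdeg : ∀ w, (f w).totalDegree ≤ δ) (hD : Fintype.card κ * δ ≤ D)
    (hB : ∀ a : σ → ℤ, (∀ i, |a i| ≤ D) → ∀ w, |eval a (f w)| ≤ B)
    (hL : B ^ Fintype.card κ < 2 ^ L) :
    ∃ (a : σ → ℤ) (p : ℕ), p.Prime ∧ p ≤ 16 * L ^ 2 ∧ ∀ w, ¬ (p : ℤ) ∣ eval a (f w) := by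
  have hF : ∏ w, f w ≠ 0 := Finset.prod_ne_zero_iff.2 fun w _ => hf w
  have hFD : (∏ w, f w).totalDegree ≤ D := by
    refine (totalDegree_finsetProd _ _).trans ((Finset.sum_le_card_nsmul _ _ δ
      fun w _ => hdeg w).trans ?_)
    simpa using hD
  obtain ⟨a, ha, ha0⟩ := exists_eval_ne_zero_of_totalDegree_le hF hFD
  have hlt : (eval a (∏ w, f w)).natAbs < 2 ^ L := by
    zify
    refine lt_of_le_of_lt ?_ hL
    rw [map_prod, Finset.abs_prod]
    exact (Finset.prod_le_prod (fun _ _ => abs_nonneg _) fun w _ => hB a ha w).trans_eq (by simp)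
  obtain ⟨p, hp, hpL, hdvd⟩ := exists_prime_le_not_dvd (Int.natAbs_ne_zero.2 ha0) hlt
  refine ⟨a, p, hp, hpL, fun w hw => hdvd (Int.natCast_dvd.1 ?_)⟩
  rw [map_prod]
  exact hw.trans (Finset.dvd_prod_of_mem _ (Finset.mem_univ w))

theorem residualGirth_le_of_monoidHom {Γ M : Type*} [Group Γ] [Monoid M] [Finite M] {S : Set Γ}
    {n c : ℕ} (τ : Γ →* M) (hc : Nat.card M ≤ c) (h : ∀ g, τ g = 1 → g ∈ S ^ n → g = 1) :
    residualGirth S n ≤ c := by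
  have hmem : ∀ g, g ∈ τ.toHomUnits.ker ↔ τ g = 1 := fun g => by
    rw [MonoidHom.mem_ker, Units.ext_iff]
    rfl
  have hindex : τ.toHomUnits.ker.index = Nat.card τ.toHomUnits.range := Subgroup.index_ker _
  refine sInf_le_of_le ⟨τ.toHomUnits.ker, inferInstance, ?_, rfl,
    fun g hg => h g ((hmem g).1 hg)⟩ ?_
  · rw [hindex]
    exact Nat.card_pos.ne'
  · rw [hindex]
    exact_mod_cast ((Nat.card_le_card_of_injective _ Subtype.val_injective).trans
      (Nat.card_le_card_of_injective _ Units.val_injective)).trans hc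

theorem pow_smul_list_prod_eq {Γ ι R R' : Type*} [Monoid Γ] [Fintype ι] [DecidableEq ι]
    [CommRing R] [CommRing R'] [Algebra R R'] {N : R}
    {ρ : Γ →* Matrix ι ι R'} {P : Γ → Matrix ι ι R} (l : List Γ)
    (hP : ∀ s ∈ l, algebraMap R R' N • ρ s = (algebraMap R R').mapMatrix (P s)) :
    algebraMap R R' N ^ l.length • ρ l.prod = (algebraMap R R').mapMatrix (l.map P).prod := by
  induction l with
  | nil => simp
  | cons s l ih =>
    rw [List.map_cons, List.prod_cons, List.prod_cons, map_mul, map_mul, ← hP s (by simp),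
      ← ih fun s hs => hP s (by simp [hs]), List.length_cons, pow_succ', smul_mul_smul_comm]

section Away

variable {Γ σ ι : Type*} [Group Γ] [Fintype ι] [DecidableEq ι]
  {N : MvPolynomial σ ℤ} {ρ : Γ →* Matrix ι ι (Localization.Away N)}
  {P : Γ → Matrix ι ι (MvPolynomial σ ℤ)}

open MvPolynomial in
/-- Elements of a given ball are separated from the identity by reduction to a matrix ring over
a small prime field. -/
theorem residualGirth_le_of_eval [Finite σ] (hN : N ≠ 0) (hρ : Function.Injective ρ) {S : Finset Γ}
    (hP : ∀ s ∈ S, algebraMap _ (Localization.Away N) N • ρ s =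
      (algebraMap _ (Localization.Away N)).mapMatrix (P s))
    {n k D L : ℕ} {b : ℤ} (hk : ∀ s ∈ S, ∀ i j, (P s i j).totalDegree ≤ k)
    (hkN : N.totalDegree ≤ k) (hD : (S.card ^ n + 1) * ((n + 1) * k) ≤ D) (hb1 : 1 ≤ b)
    (hb : ∀ a : σ → ℤ, (∀ i, |a i| ≤ D) → |eval a N| ≤ b ∧ ∀ s ∈ S, ∀ i j, |eval a (P s i j)| ≤ b)
    (hL : (((Fintype.card ι + 2) * b) ^ (n + 1)) ^ (S.card ^ n + 1) < 2 ^ L) :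
    residualGirth (S : Set Γ) n ≤ (((16 * L ^ 2) ^ (Fintype.card ι ^ 2) : ℕ) : ℕ∞) := by
  classical
  let word (w : Fin n → S) : List Γ := List.ofFn fun i => (w i : Γ)
  have hword : ∀ w, ∀ s ∈ word w, s ∈ S := fun w s hs => by
    obtain ⟨i, rfl⟩ := (List.mem_ofFn' _ _).1 hs
    exact (w i).2
  have hlen : ∀ w, (word w).length = n := fun w => List.length_ofFn
  let Q (w : Fin n → S) : Matrix ι ι (MvPolynomial σ ℤ) := ((word w).map P).prod - N ^ n • 1
  have hQdeg : ∀ w i j, (Q w i j).totalDegree ≤ (n + 1) * k := fun w i j => by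
    refine (totalDegree_sub _ _).trans (max_le ?_ ?_)
    · refine (Matrix.totalDegree_list_prod_apply_le (k := k) _ ?_ i j).trans ?_
      · intro M hM
        obtain ⟨s, hs, rfl⟩ := List.mem_map.1 hM
        exact hk s (hword w s hs)
      · rw [List.length_map, hlen]
        gcongr
        omega
    · rw [Matrix.smul_apply, Matrix.one_apply]
      split_ifs
      · rw [smul_eq_mul, mul_one]
        exact (totalDegree_pow _ _).trans (by gcongr; omega)
      · simp
  have hQeval : ∀ a : σ → ℤ, (∀ i, |a i| ≤ D) → ∀ w i j,
      |eval a (Q w i j)| ≤ ((Fintype.card ι + 2) * b) ^ (n + 1) := fun a ha w i j => by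
    have h1 : |eval a (((word w).map P).prod i j)| ≤ (Fintype.card ι * b) ^ n := by
      have h2 := Matrix.abs_list_prod_apply_le (b := b) (by omega)
        (((word w).map P).map (eval a).mapMatrix) (fun M hM => by
          rw [List.map_map] at hM
          obtain ⟨s, hs, rfl⟩ := List.mem_map.1 hM
          exact (hb a ha).2 s (hword w s hs)) i j
      rw [← map_list_prod, List.length_map, List.length_map, hlen] at h2
      exact h2
    have h3 : |eval a ((N ^ n • (1 : Matrix ι ι (MvPolynomial σ ℤ))) i j)| ≤ b ^ n := by
      rw [Matrix.smul_apply, Matrix.one_apply]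
      split_ifs
      · rw [smul_eq_mul, mul_one, map_pow, abs_pow]
        exact pow_le_pow_left₀ (abs_nonneg _) (hb a ha).1 n
      · simp
        positivity
    have h4 : (Fintype.card ι * b) ^ n ≤ ((Fintype.card ι + 2) * b) ^ n := by gcongr; omega
    have h5 : b ^ n ≤ ((Fintype.card ι + 2) * b) ^ n := by gcongr; nlinarith
    have h6 : 2 * ((Fintype.card ι + 2) * b) ^ n ≤ ((Fintype.card ι + 2) * b) ^ (n + 1) := by
      rw [pow_succ']; gcongr; nlinarith
    have h7 := abs_sub (eval a (((word w).map P).prod i j))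
      (eval a ((N ^ n • (1 : Matrix ι ι (MvPolynomial σ ℤ))) i j))
    rw [← map_sub] at h7
    exact h7.trans (by linarith)
  have hbN : b ≤ ((Fintype.card ι + 2) * b) ^ (n + 1) := by
    calc b ≤ (Fintype.card ι + 2) * b := by nlinarith
      _ ≤ _ := le_self_pow₀ (by nlinarith) (by omega)
  have hsel : ∀ w, ∃ h : MvPolynomial σ ℤ, h ≠ 0 ∧
      (Q w = 0 ∧ h = 1 ∨ ∃ i j, h = Q w i j) := fun w => by
    by_cases hw : Q w = 0
    · exact ⟨1, one_ne_zero, .inl ⟨hw, rfl⟩⟩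
    · obtain ⟨i, j, hij⟩ : ∃ i j, Q w i j ≠ 0 := by
        by_contra! h
        exact hw (Matrix.ext h)
      exact ⟨Q w i j, hij, .inr ⟨i, j, rfl⟩⟩
  choose h hh0 hh using hsel
  let f : Option (Fin n → S) → MvPolynomial σ ℤ := fun o => o.elim N h
  have hcard : Fintype.card (Option (Fin n → S)) = S.card ^ n + 1 := by simp
  obtain ⟨a, p, hp, hpL, hdvd⟩ := exists_prime_not_dvd_eval (δ := (n + 1) * k) (D := D) (L := L)
    (B := ((Fintype.card ι + 2) * b) ^ (n + 1)) f
    (by rintro (_ | w); exacts [hN, hh0 w])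
    (by
      rintro (_ | w)
      · exact hkN.trans (Nat.le_mul_of_pos_left _ (by omega))
      · rcases hh w with ⟨-, h1⟩ | ⟨i, j, h1⟩
        · simp [f, h1]
        · simpa [f, h1] using hQdeg w i j)
    (by rwa [hcard])
    (by
      rintro a ha (_ | w)
      · exact (hb a ha).1.trans hbN
      · rcases hh w with ⟨-, h1⟩ | ⟨i, j, h1⟩
        · simpa [f, h1] using hb1.trans hbN
        · simpa [f, h1] using hQeval a ha w i j)
    (by rwa [hcard])
  have : Fact p.Prime := ⟨hp⟩
  let e : MvPolynomial σ ℤ →+* ZMod p := (Int.castRingHom (ZMod p)).comp (eval a)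
  have he : ∀ x, e x = 0 ↔ (p : ℤ) ∣ eval a x := fun x => ZMod.intCast_zmod_eq_zero_iff_dvd _ p
  have heN : IsUnit (e N) := isUnit_iff_ne_zero.2 fun h0 => hdvd none ((he N).1 h0)
  let π : Localization.Away N →+* ZMod p := IsLocalization.Away.lift N heN
  have hπ : ∀ x, π (algebraMap _ _ x) = e x := fun x => IsLocalization.Away.lift_eq N heN x
  refine residualGirth_le_of_monoidHom (π.mapMatrix.toMonoidHom.comp ρ) ?_ fun g hg hgS => ?_
  · rw [show Nat.card (Matrix ι ι (ZMod p)) = p ^ (Fintype.card ι ^ 2) by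
      simp [Matrix, ← pow_mul, sq]]
    exact Nat.pow_le_pow_left hpL _
  · obtain ⟨w, rfl⟩ := Set.mem_pow.1 hgS
    have hw := pow_smul_list_prod_eq (word w) fun s hs => hP s (hword w s hs)
    rw [hlen] at hw
    have hQ : Q w = 0 := by
      rcases hh w with ⟨h1, -⟩ | ⟨i, j, h1⟩
      · exact h1
      · refine absurd ((he _).1 ?_) (hdvd (some w))
        have h2 := congrFun (congrFun (congrArg π.mapMatrix hw) i) j
        have h3 : π (ρ (word w).prod i j) = (1 : Matrix ι ι (ZMod p)) i j :=
          congrFun (congrFun hg i) j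
        have h4 : e N ^ n * (1 : Matrix ι ι (ZMod p)) i j = e (((word w).map P).prod i j) := by
          simpa [hπ, h3] using h2
        have h5 : f (some w) = ((word w).map P).prod i j - N ^ n * (1 : Matrix ι ι _) i j := h1
        rw [h5, map_sub, map_mul, map_pow, ← h4, Matrix.one_apply, Matrix.one_apply]
        split_ifs <;> simp
    have hunit : IsUnit (algebraMap _ (Localization.Away N) N ^ n) :=
      (IsLocalization.Away.algebraMap_isUnit N).pow n
    rw [sub_eq_zero.1 hQ] at hw
    refine hρ ?_
    rw [map_one]
    refine hunit.smul_left_cancel.1 (hw.trans ?_)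
    ext i j
    simp [Matrix.one_apply, apply_ite (algebraMap _ (Localization.Away N))]

open MvPolynomial in
theorem exists_residualGirth_le_pow [Finite σ] (hN : N ≠ 0) (hρ : Function.Injective ρ)
    {S : Finset Γ} (hP : ∀ s ∈ S, algebraMap _ (Localization.Away N) N • ρ s =
      (algebraMap _ (Localization.Away N)).mapMatrix (P s)) :
    ∃ C : ℕ, ∀ n, 1 ≤ n → residualGirth (S : Set Γ) n ≤ ((C ^ n : ℕ) : ℕ∞) := by
  classical
  let T : Finset (MvPolynomial σ ℤ) :=
    insert N (S.biUnion fun s => Finset.univ.image fun ij : ι × ι => P s ij.1 ij.2)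
  have hNT : N ∈ T := Finset.mem_insert_self _ _
  have hPT : ∀ s ∈ S, ∀ i j, P s i j ∈ T := fun s hs i j => Finset.mem_insert_of_mem
    (Finset.mem_biUnion.2 ⟨s, hs, Finset.mem_image.2 ⟨(i, j), Finset.mem_univ _, rfl⟩⟩)
  choose c hc using exists_abs_eval_le (σ := σ)
  let k := T.sup totalDegree
  let m := T.sup c
  have hk : ∀ x ∈ T, x.totalDegree ≤ k := fun x hx => Finset.le_sup (f := totalDegree) hx
  have hm : ∀ x ∈ T, c x ≤ m := fun x hx => Finset.le_sup (f := c) hx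
  let D (n : ℕ) := (S.card ^ n + 1) * ((n + 1) * k) + 1
  let r (n : ℕ) := Fintype.card ι + 2 + (D n + 1) * m
  let L (n : ℕ) := r n * ((n + 1) * (S.card ^ n + 1)) + 1
  have hSn : ExpBounded fun n => S.card ^ n + 1 := (ExpBounded.pow_self _).add (.const 1)
  have hn1 : ExpBounded fun n => n + 1 := ExpBounded.self.add (.const 1)
  have hDE : ExpBounded D := (hSn.mul (hn1.mul (.const k))).add (.const 1)
  have hrE : ExpBounded r := (ExpBounded.const _).add ((hDE.add (.const 1)).mul (.const m))
  have hLE : ExpBounded L := (hrE.mul (hn1.mul hSn)).add (.const 1)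
  obtain ⟨C, hC⟩ := ((ExpBounded.const 16).mul (hLE.pow 2)).pow (Fintype.card ι ^ 2)
  refine ⟨C, fun n hn => le_trans ?_ (Nat.cast_le.2 (hC n hn))⟩
  have hT : ∀ a : σ → ℤ, (∀ i, |a i| ≤ (D n : ℤ)) → ∀ x ∈ T,
      |eval a x| ≤ ((D n : ℤ) + 1) ^ m := fun a ha x hx =>
    (hc x (D n) (by simp [D]) a ha).trans
      (pow_le_pow_right₀ (by omega) (hm x hx))
  refine residualGirth_le_of_eval (k := k) (D := D n) (b := ((D n : ℤ) + 1) ^ m) hN hρ hP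
    (fun s hs i j => hk _ (hPT s hs i j)) (hk N hNT) (Nat.le_succ _)
    (one_le_pow₀ (by omega)) (fun a ha => ⟨hT a ha N hNT, fun s hs i j =>
      hT a ha _ (hPT s hs i j)⟩) ?_
  have h1 : (Fintype.card ι + 2) * (D n + 1) ^ m ≤ 2 ^ r n := by
    rw [pow_add, pow_mul]
    gcongr
    · exact Nat.lt_two_pow_self.le
    · exact Nat.lt_two_pow_self.le
  calc (((Fintype.card ι + 2) * ((D n : ℤ) + 1) ^ m) ^ (n + 1)) ^ (S.card ^ n + 1)
      ≤ ((2 ^ r n) ^ (n + 1)) ^ (S.card ^ n + 1) := by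
        gcongr
        exact_mod_cast h1
    _ = 2 ^ (r n * ((n + 1) * (S.card ^ n + 1))) := by rw [← pow_mul, ← pow_mul]
    _ < 2 ^ L n := pow_lt_pow_right₀ (by norm_num) (Nat.lt_succ_self _)

end Away

/-- The fraction field of a rational polynomial ring is the fraction field of the corresponding
integer polynomial ring. -/
theorem MvPolynomial.isFractionRing_of_isFractionRing_rat (σ F : Type*) [Field F]
    [Algebra (MvPolynomial σ ℚ) F] [IsFractionRing (MvPolynomial σ ℚ) F]
    [Algebra (MvPolynomial σ ℤ) F] (h : algebraMap (MvPolynomial σ ℤ) F =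
      (algebraMap (MvPolynomial σ ℚ) F).comp (MvPolynomial.map (Int.castRingHom ℚ))) :
    IsFractionRing (MvPolynomial σ ℤ) F := by
  let := MvPolynomial.algebraMvPolynomial (R := ℤ) (S := ℚ) (σ := σ)
  have : IsScalarTower (MvPolynomial σ ℤ) (MvPolynomial σ ℚ) F := .of_algebraMap_eq' h
  have hloc := MvPolynomial.isLocalization (σ := σ) (nonZeroDivisors ℤ) ℚ
  have hinj : Function.Injective (algebraMap (MvPolynomial σ ℤ) (MvPolynomial σ ℚ)) :=
    MvPolynomial.map_injective _ Int.cast_injective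
  have hinjF : Function.Injective (algebraMap (MvPolynomial σ ℤ) F) := by
    rw [IsScalarTower.algebraMap_eq _ (MvPolynomial σ ℚ) F]
    exact (IsFractionRing.injective _ F).comp hinj
  have := (faithfulSMul_iff_algebraMap_injective (MvPolynomial σ ℤ) F).2 hinjF
  refine IsFractionRing.of_field _ F fun z => ?_
  obtain ⟨x, y, hy, rfl⟩ := IsFractionRing.div_surjective (A := MvPolynomial σ ℚ) z
  obtain ⟨⟨x', s⟩, hx⟩ := IsLocalization.surj ((nonZeroDivisors ℤ).map (MvPolynomial.C (σ := σ))) x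
  obtain ⟨⟨y', t⟩, hy'⟩ := IsLocalization.surj ((nonZeroDivisors ℤ).map (MvPolynomial.C (σ := σ))) y
  have hne : ∀ u : (nonZeroDivisors ℤ).map (MvPolynomial.C (σ := σ)),
      algebraMap (MvPolynomial σ ℚ) F (algebraMap _ _ (u : MvPolynomial σ ℤ)) ≠ 0 := fun u =>
    ((IsLocalization.map_units (MvPolynomial σ ℚ) u).map (algebraMap _ F)).ne_zero
  have hyF : algebraMap (MvPolynomial σ ℚ) F y ≠ 0 :=
    IsFractionRing.to_map_ne_zero_of_mem_nonZeroDivisors hy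
  refine ⟨x' * t, y' * s, ?_⟩
  rw [map_mul, map_mul, IsScalarTower.algebraMap_apply _ (MvPolynomial σ ℚ) F x',
    IsScalarTower.algebraMap_apply _ (MvPolynomial σ ℚ) F y',
    IsScalarTower.algebraMap_apply _ (MvPolynomial σ ℚ) F (s : MvPolynomial σ ℤ),
    IsScalarTower.algebraMap_apply _ (MvPolynomial σ ℚ) F (t : MvPolynomial σ ℤ), ← hx, ← hy',
    map_mul, map_mul]
  have := hne s
  have := hne t
  field_simp

/-- A finite extension `B` of a domain `A` embeds into a matrix ring over the fraction field
of `A`. -/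
theorem exists_injective_ringHom_matrix_fractionRing (A B : Type*) [CommRing A] [IsDomain A]
    [CommRing B] [IsDomain B] [Algebra A B] [FaithfulSMul A B] [Module.Finite A B] :
    ∃ (e : ℕ) (f : B →+* Matrix (Fin e) (Fin e) (FractionRing A)), Function.Injective f := by
  let : Algebra (FractionRing A) (FractionRing B) := FractionRing.liftAlgebra A _
  have : IsScalarTower A (FractionRing A) (FractionRing B) :=
    FractionRing.isScalarTower_liftAlgebra A _
  have : Module.Finite (FractionRing A) (FractionRing B) :=
    have : Algebra.IsIntegral A B := inferInstance
    have : IsLocalization (Algebra.algebraMapSubmonoid B (nonZeroDivisors A)) (FractionRing B) :=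
      inferInstance
    .of_isLocalization A B (nonZeroDivisors A)
  let b := Module.finBasis (FractionRing A) (FractionRing B)
  exact ⟨_, (Algebra.leftMulMatrix b).toRingHom.comp (algebraMap B (FractionRing B)),
    (Algebra.leftMulMatrix_injective b).comp (IsFractionRing.injective B (FractionRing B))⟩

theorem Matrix.mapMatrix_injective {ι R R' : Type*} [Fintype ι] [DecidableEq ι] [Semiring R]
    [Semiring R'] {f : R →+* R'} (hf : Function.Injective f) :
    Function.Injective (f.mapMatrix (m := ι)) := Matrix.map_injective hf

/-- A finitely generated linear group over a field of characteristic zero is linear over a purely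
transcendental extension of `ℚ`. -/
theorem exists_injective_monoidHom_matrix_fractionRing {Γ ι K : Type*} [Group Γ] [Fintype ι]
    [DecidableEq ι] [Field K] [CharZero K] {S : Finset Γ} (hS : Submonoid.closure (S : Set Γ) = ⊤)
    (φ : Γ →* Matrix ι ι K) (hφ : Function.Injective φ) :
    ∃ (m e : ℕ) (ρ : Γ →* Matrix (ι × Fin e) (ι × Fin e)
      (FractionRing (MvPolynomial (Fin m) ℚ))), Function.Injective ρ := by
  classical
  let T : Finset K := S.biUnion fun s => Finset.univ.image fun ij : ι × ι => φ s ij.1 ij.2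
  let A := Algebra.adjoin ℚ (T : Set K)
  have hA : Algebra.FiniteType ℚ A := Algebra.FiniteType.adjoin_of_finite T.finite_toSet
  obtain ⟨φ', hφ'⟩ := MonoidHom.exists_comp_eq_of_closure_eq_top hS
    (A.val.toRingHom.mapMatrix (m := ι)).toMonoidHom
    (Matrix.mapMatrix_injective Subtype.val_injective) φ fun s hs =>
      ⟨Matrix.of fun i j => ⟨φ s i j, Algebra.subset_adjoin (Finset.mem_biUnion.2
        ⟨s, hs, Finset.mem_image.2 ⟨(i, j), Finset.mem_univ _, rfl⟩⟩)⟩, rfl⟩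
  have hφ'inj : Function.Injective φ' := by
    rw [← hφ', MonoidHom.coe_comp] at hφ
    exact hφ.of_comp
  obtain ⟨m, g, hg, hfin⟩ := exists_finite_inj_algHom_of_fg ℚ A
  algebraize [g.toRingHom]
  have : FaithfulSMul (MvPolynomial (Fin m) ℚ) A :=
    (faithfulSMul_iff_algebraMap_injective _ _).2 hg
  have : Module.Finite (MvPolynomial (Fin m) ℚ) A := hfin
  obtain ⟨e, f, hf⟩ := exists_injective_ringHom_matrix_fractionRing (MvPolynomial (Fin m) ℚ) A
  exact ⟨m, e, (((Matrix.compRingEquiv ι (Fin e)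
    (FractionRing (MvPolynomial (Fin m) ℚ))).toRingHom.comp f.mapMatrix).toMonoidHom.comp φ'),
    ((Matrix.compRingEquiv ι (Fin e) _).injective.comp (Matrix.mapMatrix_injective hf)).comp
      hφ'inj⟩

/-- A finitely generated linear group over the fraction field of `R` is linear over a
localization of `R` away from a single element `N`, which may be taken to clear the denominators
of the generators. -/
theorem exists_injective_monoidHom_matrix_away {Γ ι R F : Type*} [Group Γ] [Fintype ι]
    [DecidableEq ι] [CommRing R] [IsDomain R] [Field F] [Algebra R F] [IsFractionRing R F]
    {S : Finset Γ} (hS : Submonoid.closure (S : Set Γ) = ⊤) (φ : Γ →* Matrix ι ι F)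
    (hφ : Function.Injective φ) :
    ∃ N : R, N ≠ 0 ∧ ∃ (ρ : Γ →* Matrix ι ι (Localization.Away N)) (P : Γ → Matrix ι ι R),
      Function.Injective ρ ∧ ∀ s ∈ S, algebraMap R (Localization.Away N) N • ρ s =
        (algebraMap R (Localization.Away N)).mapMatrix (P s) := by
  classical
  obtain ⟨⟨N, hN⟩, hNS⟩ := IsLocalization.exist_integer_multiples_of_finset (nonZeroDivisors R)
    (S.biUnion fun s => Finset.univ.image fun ij : ι × ι => φ s ij.1 ij.2)
  have hint : ∀ s, ∃ M : Matrix ι ι R, s ∈ S → ∀ i j, algebraMap R F (M i j) = N • φ s i j :=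
    fun s => by
      by_cases hs : s ∈ S
      · have h1 : ∀ i j, ∃ x, algebraMap R F x = N • φ s i j := fun i j =>
          hNS _ (Finset.mem_biUnion.2 ⟨s, hs, Finset.mem_image.2 ⟨(i, j), Finset.mem_univ _, rfl⟩⟩)
        choose M hM using h1
        exact ⟨M, fun _ => hM⟩
      · exact ⟨0, fun h => absurd h hs⟩
  choose P hP using hint
  have hN0 : N ≠ 0 := nonZeroDivisors.ne_zero hN
  have hunit : IsUnit (algebraMap R F N) :=
    isUnit_iff_ne_zero.2 (IsFractionRing.to_map_ne_zero_of_mem_nonZeroDivisors hN)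
  let j : Localization.Away N →+* F := IsLocalization.Away.lift N hunit
  have hj : ∀ x, j (algebraMap _ _ x) = algebraMap R F x := fun x =>
    IsLocalization.Away.lift_eq N hunit x
  have hjinj : Function.Injective j := by
    refine (IsLocalization.lift_injective_iff _).2 fun x y => ?_
    rw [(IsFractionRing.injective R F).eq_iff, (IsLocalization.injective (Localization.Away N)
      (powers_le_nonZeroDivisors_of_noZeroDivisors hN0)).eq_iff]
  obtain ⟨ρ, hρ⟩ := MonoidHom.exists_comp_eq_of_closure_eq_top hS
    (j.mapMatrix (m := ι)).toMonoidHom (Matrix.mapMatrix_injective hjinj) φ fun s hs => by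
      refine ⟨IsLocalization.Away.invSelf (S := Localization.Away N) N •
        (algebraMap R (Localization.Away N)).mapMatrix (P s), ?_⟩
      ext i k
      have h1 : j (IsLocalization.Away.invSelf N) * algebraMap R F N = 1 := by
        rw [← hj, ← map_mul, mul_comm, IsLocalization.Away.mul_invSelf, map_one]
      change j (IsLocalization.Away.invSelf N * algebraMap R (Localization.Away N) (P s i k)) = φ s i k
      rw [map_mul, hj, hP s hs, Algebra.smul_def, ← mul_assoc, h1, one_mul]
  refine ⟨N, hN0, ρ, P, ?_, fun s hs => Matrix.mapMatrix_injective hjinj ?_⟩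
  · rw [← hρ, MonoidHom.coe_comp] at hφ
    exact hφ.of_comp
  · ext i k
    have h1 : j (ρ s i k) = φ s i k := congrFun (congrFun (DFunLike.congr_fun hρ s) i) k
    change j (algebraMap _ _ N * ρ s i k) = j (algebraMap _ _ (P s i k))
    rw [map_mul, hj, hj, h1, hP s hs, Algebra.smul_def]

/-- Every finitely generated group that is linear over a field of characteristic zero
has at most exponential residual girth. -/
theorem residualGirth_le_exponential_of_linear_charZero (Γ : Type) [Group Γ]
    (S : Finset Γ) (hsym : ∀ g ∈ S, g⁻¹ ∈ S) (hone : (1 : Γ) ∈ S)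
    (hgen : Subgroup.closure (S : Set Γ) = ⊤)
    (d : ℕ) (K : Type) [Field K] [CharZero K]
    (φ : Γ →* Matrix.GeneralLinearGroup (Fin d) K) (hφ : Function.Injective φ) :
    ∃ C : ℕ, 1 < C ∧ ∀ n : ℕ, residualGirth (S : Set Γ) n ≤ ((C ^ n : ℕ) : ℕ∞) := by
  have hS : Submonoid.closure (S : Set Γ) = ⊤ := by
    have hinv : (S : Set Γ)⁻¹ ⊆ S := fun g hg => by simpa using hsym g⁻¹ hg
    rw [← Set.union_eq_left.2 hinv, ← Subgroup.closure_toSubmonoid, hgen, Subgroup.top_toSubmonoid]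
  obtain ⟨m, e, ψ, hψ⟩ := exists_injective_monoidHom_matrix_fractionRing hS
    ((Units.coeHom _).comp φ) (Units.val_injective.comp hφ)
  let F := FractionRing (MvPolynomial (Fin m) ℚ)
  let : Algebra (MvPolynomial (Fin m) ℤ) F := ((algebraMap (MvPolynomial (Fin m) ℚ) F).comp
    (MvPolynomial.map (Int.castRingHom ℚ))).toAlgebra
  have := MvPolynomial.isFractionRing_of_isFractionRing_rat (Fin m) F rfl
  obtain ⟨N, hN, ρ, P, hρ, hP⟩ :=
    exists_injective_monoidHom_matrix_away (R := MvPolynomial (Fin m) ℤ) hS ψ hψ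
  obtain ⟨C, hC⟩ := exists_residualGirth_le_pow hN hρ hP
  refine ⟨C + 2, by omega, fun n => ?_⟩
  rcases Nat.eq_zero_or_pos n with rfl | hn
  · rw [pow_zero]
    exact residualGirth_le_of_monoidHom (1 : Γ →* Unit) (by simp) fun g _ hg => by simpa using hg
  · exact (hC n hn).trans (Nat.cast_le.2 (Nat.pow_le_pow_left (by omega) n))
end
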